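/- Suppose x̲ < x ≤ x̄ and x > x_c. Then v(x) = min(v1(x), v2(x)). Furthermore, if v1(x) < v2(x), the strategy α*(t) := M(t)·1_{[0,t_c]}(t) + m(t)·1_{(t_c,T]}(t) attains the infimum defining v(x); otherwise, the strategy α*(t) := M(t) for all t ∈ [0,T] attains it. -/

import Mathlib

open MeasureTheory Set

noncomputable section

/-- Admissible repayment strategies: measurable, with `m t ≤ α t ≤ M t` on `[0,T]`. -/
def Adm (T : ℝ) (m M : ℝ → ℝ) : Set (ℝ → ℝ) :=
  {α | Measurable α ∧ ∀ t ∈ Icc (0:ℝ) T, m t ≤ α t ∧ α t ≤ M t}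

/-- Compound-interest balance. -/
def balC (r β x : ℝ) (α : ℝ → ℝ) (t : ℝ) : ℝ :=
  Real.exp ((r + β) * t) * (x - ∫ s in (0:ℝ)..t, Real.exp (-(r + β) * s) * α s)

/-- Terminal time: first zero of the balance in `[0,T]`, capped at `T`. -/
def tauC (r β T x : ℝ) (α : ℝ → ℝ) : ℝ :=
  sInf (insert T {t | t ∈ Icc (0:ℝ) T ∧ balC r β x α t = 0})

/-- Repayment cost. -/
def costC (r β T ω x : ℝ) (α : ℝ → ℝ) : ℝ :=
  (∫ t in (0:ℝ)..(tauC r β T x α), Real.exp (-r * t) * α t)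
    + ω * Real.exp (-r * tauC r β T x α) * balC r β x α (tauC r β T x α)

/-- Value function. -/
def valC (r β T ω : ℝ) (m M : ℝ → ℝ) (x : ℝ) : ℝ :=
  sInf (costC r β T ω x '' Adm T m M)

/-- Critical horizon `t_c = max(T + log ω / β, 0)`. -/
def tCrit (β T ω : ℝ) : ℝ := max (T + Real.log ω / β) 0

/-- The cost `v₁` of the max-min strategy. -/
def vOne (r β T ω : ℝ) (m M : ℝ → ℝ) (x : ℝ) : ℝ :=
  (∫ s in (0:ℝ)..(tCrit β T ω), Real.exp (-r * s) * M s)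
  + (∫ s in (tCrit β T ω)..T, Real.exp (-r * s) * m s)
  + ω * Real.exp (β * T) *
    (x - (∫ s in (0:ℝ)..(tCrit β T ω), Real.exp (-(r + β) * s) * M s)
       - ∫ s in (tCrit β T ω)..T, Real.exp (-(r + β) * s) * m s)

/-- `x̂ = ∫_0^{t_c} e^{-(r+β)s} M(s) ds`. -/
def xHat (r β T ω : ℝ) (M : ℝ → ℝ) : ℝ :=
  ∫ s in (0:ℝ)..(tCrit β T ω), Real.exp (-(r + β) * s) * M s

/-- `x̄ = ∫_0^T e^{-(r+β)s} M(s) ds`. -/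
def xBar (r β T : ℝ) (M : ℝ → ℝ) : ℝ :=
  ∫ s in (0:ℝ)..T, Real.exp (-(r + β) * s) * M s

/-- `x̲ = ∫_0^T e^{-(r+β)s} m(s) ds`. -/
def xLow (r β T : ℝ) (m : ℝ → ℝ) : ℝ :=
  ∫ s in (0:ℝ)..T, Real.exp (-(r + β) * s) * m s

/-- `x_c = ∫_0^{t_c} e^{-(r+β)s} M(s) ds + ∫_{t_c}^T e^{-(r+β)s} m(s) ds`. -/
def xCrit (r β T ω : ℝ) (m M : ℝ → ℝ) : ℝ :=
  xHat r β T ω M + ∫ s in (tCrit β T ω)..T, Real.exp (-(r + β) * s) * m s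

lemma integrableOn_exp_mul_of_mem_Adm {T : ℝ} {m M α : ℝ → ℝ} (hα : α ∈ Adm T m M)
    (hmInt : IntegrableOn m (Icc (0:ℝ) T)) (hMInt : IntegrableOn M (Icc (0:ℝ) T)) (c : ℝ) :
    IntegrableOn (fun s => Real.exp (c * s) * α s) (Icc (0:ℝ) T) := by
  have hαI : IntegrableOn α (Icc (0:ℝ) T) := by
    refine integrable_of_le_of_le hα.1.aestronglyMeasurable ?_ ?_ hmInt hMInt
    · exact (ae_restrict_iff' measurableSet_Icc).2 (.of_forall fun t ht => (hα.2 t ht).1)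
    · exact (ae_restrict_iff' measurableSet_Icc).2 (.of_forall fun t ht => (hα.2 t ht).2)
  exact hαI.continuousOn_mul (by fun_prop) isCompact_Icc

lemma intervalIntegrable_of_integrableOn_Icc {f : ℝ → ℝ} {T a b : ℝ}
    (hf : IntegrableOn f (Icc (0:ℝ) T)) (ha : a ∈ Icc (0:ℝ) T) (hb : b ∈ Icc (0:ℝ) T) :
    IntervalIntegrable f volume a b :=
  (hf.mono_set (uIcc_subset_Icc ha hb)).intervalIntegrable

/-- Bang-bang comparison: the weight `e^{-rs} - K e^{-(r+β)s}` changes sign from nonpositive to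
nonnegative at `c`, so the linear functional it defines is minimised by taking the upper bound
before `c` and the lower bound after `c`. -/
lemma bang_bang_le {r β K T c τ : ℝ} {α l M : ℝ → ℝ} (hc : 0 ≤ c) (hcτ : c ≤ τ) (hτT : τ ≤ T)
    (hα : ∀ k : ℝ, IntegrableOn (fun s => Real.exp (k * s) * α s) (Icc (0:ℝ) T))
    (hl : ∀ k : ℝ, IntegrableOn (fun s => Real.exp (k * s) * l s) (Icc (0:ℝ) T))
    (hM : ∀ k : ℝ, IntegrableOn (fun s => Real.exp (k * s) * M s) (Icc (0:ℝ) T))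
    (hαM : ∀ s ∈ Icc (0:ℝ) T, l s ≤ α s ∧ α s ≤ M s)
    (hKc : ∀ s ∈ Ioo 0 c, Real.exp (β * s) ≤ K) (hcK : ∀ s ∈ Ioo c τ, K ≤ Real.exp (β * s)) :
    (∫ s in (0:ℝ)..c, Real.exp (-r * s) * M s) + (∫ s in c..τ, Real.exp (-r * s) * l s)
      - K * ((∫ s in (0:ℝ)..c, Real.exp (-(r + β) * s) * M s)
        + ∫ s in c..τ, Real.exp (-(r + β) * s) * l s)
      ≤ (∫ s in (0:ℝ)..τ, Real.exp (-r * s) * α s)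
        - K * ∫ s in (0:ℝ)..τ, Real.exp (-(r + β) * s) * α s := by
  have h0 : (0:ℝ) ∈ Icc (0:ℝ) T := ⟨le_rfl, by linarith⟩
  have hcm : c ∈ Icc (0:ℝ) T := ⟨hc, by linarith⟩
  have hτm : τ ∈ Icc (0:ℝ) T := ⟨by linarith, hτT⟩
  have ii : ∀ {f : ℝ → ℝ} {a b : ℝ}, IntegrableOn f (Icc (0:ℝ) T) → a ∈ Icc (0:ℝ) T →
      b ∈ Icc (0:ℝ) T → IntervalIntegrable f volume a b :=
    fun hf ha hb => intervalIntegrable_of_integrableOn_Icc hf ha hb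
  have hexp : ∀ s, Real.exp (-r * s) = Real.exp (β * s) * Real.exp (-(r + β) * s) := fun s => by
    rw [← Real.exp_add]; ring_nf
  rw [← intervalIntegral.integral_add_adjacent_intervals
      (ii (hα (-r)) h0 hcm) (ii (hα (-r)) hcm hτm),
    ← intervalIntegral.integral_add_adjacent_intervals
      (ii (hα (-(r + β))) h0 hcm) (ii (hα (-(r + β))) hcm hτm)]
  have h1 : (∫ s in (0:ℝ)..c, (Real.exp (-r * s) * M s - K * (Real.exp (-(r + β) * s) * M s)))
      ≤ ∫ s in (0:ℝ)..c, (Real.exp (-r * s) * α s - K * (Real.exp (-(r + β) * s) * α s)) := by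
    refine intervalIntegral.integral_mono_on_of_le_Ioo hc
      ((ii (hM _) h0 hcm).sub ((ii (hM _) h0 hcm).const_mul K))
      ((ii (hα _) h0 hcm).sub ((ii (hα _) h0 hcm).const_mul K)) fun s hs => ?_
    rw [hexp s]
    have := mul_nonneg (mul_nonneg (sub_nonneg.2 (hKc s hs)) (Real.exp_pos (-(r + β) * s)).le)
      (sub_nonneg.2 (hαM s ⟨hs.1.le, by linarith [hs.2]⟩).2)
    linarith
  have h2 : (∫ s in c..τ, (Real.exp (-r * s) * l s - K * (Real.exp (-(r + β) * s) * l s)))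
      ≤ ∫ s in c..τ, (Real.exp (-r * s) * α s - K * (Real.exp (-(r + β) * s) * α s)) := by
    refine intervalIntegral.integral_mono_on_of_le_Ioo hcτ
      ((ii (hl _) hcm hτm).sub ((ii (hl _) hcm hτm).const_mul K))
      ((ii (hα _) hcm hτm).sub ((ii (hα _) hcm hτm).const_mul K)) fun s hs => ?_
    rw [hexp s]
    have := mul_nonneg (mul_nonneg (sub_nonneg.2 (hcK s hs)) (Real.exp_pos (-(r + β) * s)).le)
      (sub_nonneg.2 (hαM s ⟨by linarith [hs.1], by linarith [hs.2]⟩).1)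
    linarith
  rw [intervalIntegral.integral_sub (ii (hM _) h0 hcm) ((ii (hM _) h0 hcm).const_mul K),
    intervalIntegral.integral_sub (ii (hα _) h0 hcm) ((ii (hα _) h0 hcm).const_mul K),
    intervalIntegral.integral_const_mul, intervalIntegral.integral_const_mul] at h1
  rw [intervalIntegral.integral_sub (ii (hl _) hcm hτm) ((ii (hl _) hcm hτm).const_mul K),
    intervalIntegral.integral_sub (ii (hα _) hcm hτm) ((ii (hα _) hcm hτm).const_mul K),
    intervalIntegral.integral_const_mul, intervalIntegral.integral_const_mul] at h2
  linarith

lemma balC_eq_zero_iff {r β x t : ℝ} {α : ℝ → ℝ} :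
    balC r β x α t = 0 ↔ (∫ s in (0:ℝ)..t, Real.exp (-(r + β) * s) * α s) = x := by
  simp only [balC, mul_eq_zero, Real.exp_ne_zero, false_or, sub_eq_zero]
  exact eq_comm

/-- The terminal time is either the horizon or a zero of the balance. -/
lemma tauC_eq_or_mem {r β T x : ℝ} {α : ℝ → ℝ} (hT : 0 ≤ T)
    (hα : IntegrableOn (fun s => Real.exp (-(r + β) * s) * α s) (Icc (0:ℝ) T)) :
    tauC r β T x α = T ∨ tauC r β T x α ∈ Icc (0:ℝ) T ∧
      (∫ s in (0:ℝ)..(tauC r β T x α), Real.exp (-(r + β) * s) * α s) = x := by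
  have hcont : ContinuousOn (balC r β x α) (Icc (0:ℝ) T) := by
    have h : ContinuousOn (fun t => ∫ s in (0:ℝ)..t, Real.exp (-(r + β) * s) * α s)
        (Icc (0:ℝ) T) := by
      have := intervalIntegral.continuousOn_primitive_interval
        (μ := volume) (f := fun s => Real.exp (-(r + β) * s) * α s) (a := 0) (b := T)
        (by rwa [uIcc_of_le hT])
      rwa [uIcc_of_le hT] at this
    unfold balC
    exact (by fun_prop : Continuous fun t : ℝ => Real.exp ((r + β) * t)).continuousOn.mul
      (continuousOn_const.sub h)
  have hcomp : IsCompact (insert T {t | t ∈ Icc (0:ℝ) T ∧ balC r β x α t = 0}) := by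
    refine IsCompact.insert ((isCompact_Icc (a := (0:ℝ)) (b := T)).of_isClosed_subset
      (hcont.preimage_isClosed_of_isClosed isClosed_Icc isClosed_singleton (t := {0})) ?_) T
    exact fun t ht => ht.1
  rcases hcomp.sInf_mem (insert_nonempty _ _) with h | h
  · exact .inl h
  · exact .inr ⟨h.1, balC_eq_zero_iff.1 h.2⟩

lemma costC_of_tauC_eq {r β T ω x : ℝ} {α : ℝ → ℝ} (h : tauC r β T x α = T) :
    costC r β T ω x α = (∫ t in (0:ℝ)..T, Real.exp (-r * t) * α t)
      + ω * Real.exp (β * T) * (x - ∫ s in (0:ℝ)..T, Real.exp (-(r + β) * s) * α s) := by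
  have : Real.exp (β * T) = Real.exp (-r * T) * Real.exp ((r + β) * T) := by
    rw [← Real.exp_add]; ring_nf
  rw [costC, h, balC, this]
  ring

lemma costC_of_integral_eq {r β T ω x : ℝ} {α : ℝ → ℝ}
    (h : (∫ s in (0:ℝ)..(tauC r β T x α), Real.exp (-(r + β) * s) * α s) = x) :
    costC r β T ω x α = ∫ t in (0:ℝ)..(tauC r β T x α), Real.exp (-r * t) * α t := by
  rw [costC, balC_eq_zero_iff.2 h]
  ring

/-- for `x̲ < x ≤ x̄` with `x > x_c`, `v(x) = min(v₁(x), v₂(x))`;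
the max-min strategy attains the infimum if `v₁(x) < v₂(x)`, otherwise the max
strategy does. -/
theorem stmt6 (r β T ω : ℝ) (m M : ℝ → ℝ)
    (hr : 0 < r) (hβ : 0 < β) (hT : 0 < T) (hω : ω ∈ Ioo (0:ℝ) 1)
    (hmMeas : Measurable m) (hMMeas : Measurable M)
    (hmInt : IntegrableOn m (Icc (0:ℝ) T)) (hMInt : IntegrableOn M (Icc (0:ℝ) T))
    (hmM : ∀ t ∈ Icc (0:ℝ) T, 0 < m t ∧ m t < M t)
    (x : ℝ) (hx1 : xLow r β T m < x) (hx2 : x ≤ xBar r β T M)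
    (hx3 : xCrit r β T ω m M < x)
    (tM : ℝ) (htM : tM ∈ Ioc (0:ℝ) T)
    (htMEq : x = ∫ s in (0:ℝ)..tM, Real.exp (-(r + β) * s) * M s)
    (htMuniq : ∀ t' ∈ Ioc (0:ℝ) T,
      x = (∫ s in (0:ℝ)..t', Real.exp (-(r + β) * s) * M s) → t' = tM) :
    valC r β T ω m M x
      = min (vOne r β T ω m M x) (∫ s in (0:ℝ)..tM, Real.exp (-r * s) * M s) ∧
    (vOne r β T ω m M x < (∫ s in (0:ℝ)..tM, Real.exp (-r * s) * M s) →
      (fun t => if t ≤ tCrit β T ω then M t else m t) ∈ Adm T m M ∧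
      costC r β T ω x (fun t => if t ≤ tCrit β T ω then M t else m t)
        = valC r β T ω m M x) ∧
    (¬ vOne r β T ω m M x < (∫ s in (0:ℝ)..tM, Real.exp (-r * s) * M s) →
      M ∈ Adm T m M ∧ costC r β T ω x M = valC r β T ω m M x) := by
  obtain ⟨hω0, hω1⟩ := hω
  have h0 : (0:ℝ) ∈ Icc (0:ℝ) T := ⟨le_rfl, hT.le⟩
  have hTm : T ∈ Icc (0:ℝ) T := ⟨hT.le, le_rfl⟩
  have hMm : tM ∈ Icc (0:ℝ) T := ⟨htM.1.le, htM.2⟩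
  set c := tCrit β T ω with hc
  have hlog : Real.log ω / β < 0 := div_neg_of_neg_of_pos (Real.log_neg hω0 hω1) hβ
  have hcm : c ∈ Icc (0:ℝ) T :=
    ⟨le_max_right _ _, max_le (by linarith) hT.le⟩
  have hMA : M ∈ Adm T m M := ⟨hMMeas, fun t ht => ⟨(hmM t ht).2.le, le_rfl⟩⟩
  have hmA : m ∈ Adm T m M := ⟨hmMeas, fun t ht => ⟨le_rfl, (hmM t ht).2.le⟩⟩
  set σ : ℝ → ℝ := fun t => if t ≤ c then M t else m t with hσ
  have hσA : σ ∈ Adm T m M := by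
    refine ⟨Measurable.ite measurableSet_Iic hMMeas hmMeas, fun t ht => ?_⟩
    by_cases h : t ≤ c
    · simpa [hσ, h] using (hmM t ht).2.le
    · simpa [hσ, h] using (hmM t ht).2.le
  have hI : ∀ {α}, α ∈ Adm T m M → ∀ k : ℝ,
      IntegrableOn (fun s => Real.exp (k * s) * α s) (Icc (0:ℝ) T) :=
    fun hα k => integrableOn_exp_mul_of_mem_Adm hα hmInt hMInt k
  have ii : ∀ {f : ℝ → ℝ} {a b : ℝ}, IntegrableOn f (Icc (0:ℝ) T) → a ∈ Icc (0:ℝ) T →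
      b ∈ Icc (0:ℝ) T → IntervalIntegrable f volume a b :=
    fun hf ha hb => intervalIntegrable_of_integrableOn_Icc hf ha hb
  have hpos : ∀ {α a b}, α ∈ Adm T m M → a ∈ Icc (0:ℝ) T → b ∈ Icc (0:ℝ) T → a < b →
      0 < ∫ s in a..b, Real.exp (-(r + β) * s) * α s := by
    intro α a b hα ha hb hab
    refine intervalIntegral.intervalIntegral_pos_of_pos_on (ii (hI hα _) ha hb)
      (fun s hs => ?_) hab
    have hs' : s ∈ Icc (0:ℝ) T := ⟨ha.1.trans hs.1.le, hs.2.le.trans hb.2⟩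
    exact mul_pos (Real.exp_pos _) ((hmM s hs').1.trans_le (hα.2 s hs').1)
  have hx0 : 0 < x := htMEq ▸ hpos hMA h0 hMm htM.1
  -- integrals of the max-min strategy
  have hσint : ∀ k : ℝ, (∫ s in (0:ℝ)..T, Real.exp (k * s) * σ s)
      = (∫ s in (0:ℝ)..c, Real.exp (k * s) * M s) + ∫ s in c..T, Real.exp (k * s) * m s := by
    intro k
    rw [← intervalIntegral.integral_add_adjacent_intervals
      (ii (hI hσA k) h0 hcm) (ii (hI hσA k) hcm hTm)]
    congr 1
    · refine intervalIntegral.integral_congr_ae (.of_forall fun s hs => ?_)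
      rw [uIoc_of_le hcm.1] at hs
      simp [hσ, hs.2]
    · refine intervalIntegral.integral_congr_ae (.of_forall fun s hs => ?_)
      rw [uIoc_of_le hcm.2] at hs
      simp [hσ, not_le.2 hs.1]
  -- value of the max-min strategy
  have hσcost : costC r β T ω x σ = vOne r β T ω m M x := by
    have hτ : tauC r β T x σ = T := by
      refine (tauC_eq_or_mem hT.le (hI hσA _)).resolve_right fun ⟨hm, he⟩ => ?_
      have hsplit := intervalIntegral.integral_add_adjacent_intervals
        (ii (hI hσA (-(r + β))) h0 hm) (ii (hI hσA (-(r + β))) hm hTm)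
      rw [he, hσint] at hsplit
      have hnn : 0 ≤ ∫ s in (tauC r β T x σ)..T, Real.exp (-(r + β) * s) * σ s := by
        rcases hm.2.eq_or_lt with h | h
        · rw [h, intervalIntegral.integral_same]
        · exact (hpos hσA hm hTm h).le
      rw [xCrit, xHat] at hx3
      linarith
    rw [costC_of_tauC_eq hτ, hσint, hσint, vOne]
    ring
  -- value of the max strategy
  have hMcost : costC r β T ω x M = ∫ s in (0:ℝ)..tM, Real.exp (-r * s) * M s := by
    have hτ : tauC r β T x M = tM := by
      rcases tauC_eq_or_mem (x := x) hT.le (hI hMA (-(r + β))) with h | ⟨hm, he⟩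
      · refine le_antisymm ?_ (htM.2.trans h.ge)
        refine csInf_le ⟨0, ?_⟩ (.inr ⟨hMm, balC_eq_zero_iff.2 htMEq.symm⟩)
        rintro t (rfl | ht)
        exacts [hT.le, ht.1.1]
      · refine htMuniq _ ⟨lt_of_le_of_ne hm.1 fun h => ?_, hm.2⟩ he.symm
        rw [← h, intervalIntegral.integral_same] at he
        linarith
    rw [costC_of_integral_eq (by rw [hτ]; exact htMEq.symm), hτ]
  -- every strategy costs at least one of the two
  have hlow : ∀ α ∈ Adm T m M, min (vOne r β T ω m M x)
      (∫ s in (0:ℝ)..tM, Real.exp (-r * s) * M s) ≤ costC r β T ω x α := by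
    intro α hα
    rcases tauC_eq_or_mem (x := x) hT.le (hI hα (-(r + β))) with h | ⟨hm, he⟩
    · refine (min_le_left _ _).trans ?_
      have hK : ω * Real.exp (β * T) = Real.exp (β * (T + Real.log ω / β)) := by
        rw [mul_add, mul_div_cancel₀ _ hβ.ne', Real.exp_add, Real.exp_log hω0, mul_comm]
      have := bang_bang_le (r := r) (β := β) (K := ω * Real.exp (β * T)) hcm.1 hcm.2 le_rfl
        (hI hα) (hI hmA) (hI hMA) hα.2
        (fun s hs => by
          have hs2 : s < T + Real.log ω / β :=
            (lt_max_iff.1 hs.2).resolve_right (not_lt.2 hs.1.le)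
          rw [hK]; gcongr)
        (fun s hs => by
          have hs2 : T + Real.log ω / β < s := (le_max_left _ _).trans_lt hs.1
          rw [hK]; gcongr)
      rw [costC_of_tauC_eq h, vOne]
      linarith
    · refine (min_le_right _ _).trans ?_
      rw [costC_of_integral_eq he]
      set τ := tauC r β T x α
      have hle : tM ≤ τ := by
        by_contra! hlt
        have h1 := hpos hMA hm hMm hlt
        have h2 := intervalIntegral.integral_add_adjacent_intervals
          (ii (hI hMA (-(r + β))) h0 hm) (ii (hI hMA (-(r + β))) hm hMm)
        have h3 := intervalIntegral.integral_mono_on hm.1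
          (ii (hI hα (-(r + β))) h0 hm) (ii (hI hMA (-(r + β))) h0 hm) fun s hs =>
            mul_le_mul_of_nonneg_left (hα.2 s ⟨hs.1, hs.2.trans hm.2⟩).2 (Real.exp_pos _).le
        linarith
      have := bang_bang_le (r := r) (β := β) (K := Real.exp (β * tM)) (l := fun _ => 0)
        htM.1.le hle hm.2 (hI hα) (fun k => by simp) (hI hMA)
        (fun s hs => ⟨((hmM s hs).1.trans_le (hα.2 s hs).1).le, (hα.2 s hs).2⟩)
        (fun s hs => by have := hs.2; gcongr)
        (fun s hs => by have := hs.1; gcongr)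
      rw [he, ← htMEq] at this
      simp only [mul_zero, intervalIntegral.integral_zero] at this
      linarith
  have hval : valC r β T ω m M x = min (vOne r β T ω m M x)
      (∫ s in (0:ℝ)..tM, Real.exp (-r * s) * M s) := by
    refine IsLeast.csInf_eq ⟨?_, ?_⟩
    · rcases min_choice (vOne r β T ω m M x)
        (∫ s in (0:ℝ)..tM, Real.exp (-r * s) * M s) with h | h
      · exact ⟨σ, hσA, hσcost.trans h.symm⟩
      · exact ⟨M, hMA, hMcost.trans h.symm⟩
    · rintro _ ⟨α, hα, rfl⟩
      exact hlow α hα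
  refine ⟨hval, fun h => ⟨hσA, ?_⟩, fun h => ⟨hMA, ?_⟩⟩
  · rw [hσcost, hval, min_eq_left h.le]
  · rw [hMcost, hval, min_eq_right (not_lt.1 h)]
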